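/- Let m and n be positive integers. A map f : L_{m,n} → [mn] is an injective L-shape of difference equation type of size (m,n) (i.e. f ∈ E^{1,in}_{m,n}) if and only if there exists a real number ξ > 0 such that the ranking table τ^{m,n}_ξ is injective on [m]×[n] and f(i,j) = τ^{m,n}_ξ(i,j) for all (i,j) ∈ L_{m,n}. (In the paper's notation: LY_{m,n} = E^{1,in}_{m,n}, i.e. the injective L-shapes of difference equation type are exactly the L-shape restrictions of Young ranking tables.) -/

import Mathlib

open Finset
open scoped Classical

/-- The ranking table `τ^{m,n}_ξ(i,j) = #{(s,t) ∈ [m]×[n] : s + tξ ≤ i + jξ}`. -/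
noncomputable def tau (m n : ℕ) (ξ : ℝ) (i j : ℕ) : ℕ :=
  ((Finset.Icc 1 m ×ˢ Finset.Icc 1 n).filter
    (fun p => (p.1 : ℝ) + (p.2 : ℝ) * ξ ≤ (i : ℝ) + (j : ℝ) * ξ)).card

/-- `Δ_{m,n}(ξ) = τ^{m,n}_ξ(m,1) − τ^{m,n}_ξ(1,n)` as an integer. -/
noncomputable def Delta (m n : ℕ) (ξ : ℝ) : ℤ :=
  (tau m n ξ m 1 : ℤ) - (tau m n ξ 1 n : ℤ)

/-- The L-shape domain `L_{m,n} = ([m]×{1}) ∪ ({1}×[n])`. -/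
def LShape (m n : ℕ) : Finset (ℕ × ℕ) :=
  (Finset.Icc 1 m ×ˢ ({1} : Finset ℕ)) ∪ (({1} : Finset ℕ) ×ˢ Finset.Icc 1 n)

/-- The condition `E_{m,n}` on a map defined (at least) on the L-shape. -/
def condE (m n : ℕ) (f : ℕ × ℕ → ℕ) : Prop :=
  (∀ i ∈ Finset.Icc 1 (m - 1),
    (f (i + 1, 1) : ℤ) - (f (i, 1) : ℤ) =
      ((Finset.Icc 1 n).filter (fun t => f (1, t) ≤ f (i + 1, 1))).card) ∧
  (∀ j ∈ Finset.Icc 1 (n - 1),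
    (f (1, j + 1) : ℤ) - (f (1, j) : ℤ) =
      ((Finset.Icc 1 m).filter (fun s => f (s, 1) ≤ f (1, j + 1))).card)

/-- `f` is an injective L-shape of difference equation type of size `(m,n)`:
an injection from `L_{m,n}` into `[mn]` satisfying `E_{m,n}` with `f(1,1) = 1`. -/
def isLShapeDE (m n : ℕ) (f : ℕ × ℕ → ℕ) : Prop :=
  Set.InjOn f (LShape m n) ∧ (∀ p ∈ LShape m n, f p ∈ Finset.Icc 1 (m * n)) ∧
    f (1, 1) = 1 ∧ condE m n f

lemma mem_tauSet {m n : ℕ} {ξ : ℝ} {i j : ℕ} {p : ℕ × ℕ} :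
    p ∈ ((Finset.Icc 1 m ×ˢ Finset.Icc 1 n).filter
      (fun p => (p.1 : ℝ) + (p.2 : ℝ) * ξ ≤ (i : ℝ) + (j : ℝ) * ξ)) ↔
    ((1 ≤ p.1 ∧ p.1 ≤ m) ∧ (1 ≤ p.2 ∧ p.2 ≤ n)) ∧
      (p.1 : ℝ) + (p.2 : ℝ) * ξ ≤ (i : ℝ) + (j : ℝ) * ξ := by
  simp [Finset.mem_filter, Finset.mem_product]

/-- in the rectangle, the table is ordered like the values -/
lemma tau_le_iff {m n : ℕ} {ξ : ℝ} {i j k l : ℕ} (hi : 1 ≤ i) (hi' : i ≤ m) (hj : 1 ≤ j)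
    (hj' : j ≤ n) :
    tau m n ξ i j ≤ tau m n ξ k l ↔ (i : ℝ) + j * ξ ≤ k + l * ξ := by
  constructor
  · intro h
    by_contra hc
    push Not at hc
    have : tau m n ξ k l < tau m n ξ i j := by
      unfold tau
      apply Finset.card_lt_card
      rw [Finset.ssubset_iff_of_subset]
      · refine ⟨(i, j), ?_, ?_⟩
        · rw [mem_tauSet]; exact ⟨⟨⟨hi, hi'⟩, hj, hj'⟩, le_refl _⟩
        · rw [mem_tauSet]; rintro ⟨_, h2⟩; simp only at h2; linarith
      · intro p; rw [mem_tauSet, mem_tauSet]; rintro ⟨h1, h2⟩; exact ⟨h1, by linarith⟩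
    omega
  · intro h
    unfold tau
    apply Finset.card_le_card
    intro p; rw [mem_tauSet, mem_tauSet]; rintro ⟨h1, h2⟩; exact ⟨h1, by linarith⟩

lemma tau_symm (m n : ℕ) {ξ : ℝ} (hξ : 0 < ξ) (i j : ℕ) :
    tau m n ξ i j = tau n m ξ⁻¹ j i := by
  have key : ∀ s t : ℕ, (s : ℝ) + t * ξ ≤ i + j * ξ ↔ (t : ℝ) + s * ξ⁻¹ ≤ j + i * ξ⁻¹ := by
    intro s t
    rw [← mul_le_mul_iff_left₀ (inv_pos.mpr hξ)]
    have e1 : ((s : ℝ) + t * ξ) * ξ⁻¹ = t + s * ξ⁻¹ := by field_simp; ring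
    have e2 : ((i : ℝ) + j * ξ) * ξ⁻¹ = j + i * ξ⁻¹ := by field_simp; ring
    rw [e1, e2]
  unfold tau
  refine Finset.card_bij' (fun p _ => p.swap) (fun p _ => p.swap) ?_ ?_ ?_ ?_
  · intro p; rw [mem_tauSet, mem_tauSet]; rintro ⟨⟨h1, h2⟩, h3⟩
    exact ⟨⟨h2, h1⟩, (key _ _).1 h3⟩
  · intro p; rw [mem_tauSet, mem_tauSet]; rintro ⟨⟨h1, h2⟩, h3⟩
    exact ⟨⟨h2, h1⟩, (key _ _).2 h3⟩
  · intro p _; simp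
  · intro p _; simp

lemma tau_one_one {m n : ℕ} (hm : 1 ≤ m) (hn : 1 ≤ n) {ξ : ℝ} (hξ : 0 < ξ) :
    tau m n ξ 1 1 = 1 := by
  unfold tau
  rw [Finset.card_eq_one]
  refine ⟨(1, 1), ?_⟩
  ext ⟨s, t⟩
  rw [mem_tauSet, Finset.mem_singleton]
  constructor
  · rintro ⟨⟨⟨h1, h2⟩, h3, h4⟩, h5⟩
    simp only at *
    have h1' : (1 : ℝ) ≤ s := by exact_mod_cast h1
    have h3' : (1 : ℝ) ≤ t := by exact_mod_cast h3
    push_cast at h5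
    have hs : (s : ℝ) ≤ 1 := by nlinarith
    have ht : (t : ℝ) ≤ 1 := by
      by_contra hc
      push Not at hc
      nlinarith
    have hs' : s ≤ 1 := by exact_mod_cast hs
    have ht' : t ≤ 1 := by exact_mod_cast ht
    ext <;> simp <;> omega
  · intro h
    obtain ⟨rfl, rfl⟩ := Prod.mk.inj h
    exact ⟨⟨⟨le_refl _, hm⟩, le_refl _, hn⟩, le_refl _⟩

/-- the difference equation for the first column -/
lemma tau_succ {m n : ℕ} {ξ : ℝ} (hξ : 0 < ξ) {i : ℕ} (hi : 1 ≤ i) (him : i + 1 ≤ m) :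
    tau m n ξ (i + 1) 1 = tau m n ξ i 1 +
      ((Finset.Icc 1 n).filter
        (fun t : ℕ => (1 : ℝ) + (t : ℝ) * ξ ≤ (i : ℝ) + 1 + ξ)).card := by
  have hset : ((Finset.Icc 1 m ×ˢ Finset.Icc 1 n).filter
      (fun p => (p.1 : ℝ) + (p.2 : ℝ) * ξ ≤ ((i + 1 : ℕ) : ℝ) + ((1 : ℕ) : ℝ) * ξ)) =
      (((Finset.Icc 1 m ×ˢ Finset.Icc 1 n).filter
      (fun p => (p.1 : ℝ) + (p.2 : ℝ) * ξ ≤ (i : ℝ) + ((1 : ℕ) : ℝ) * ξ)).image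
        (fun p => (p.1 + 1, p.2))) ∪
      (((Finset.Icc 1 n).filter
        (fun t : ℕ => (1 : ℝ) + (t : ℝ) * ξ ≤ (i : ℝ) + 1 + ξ)).image (fun t => (1, t))) := by
    ext ⟨s, t⟩
    rw [mem_tauSet, Finset.mem_union, Finset.mem_image, Finset.mem_image]
    constructor
    · rintro ⟨⟨⟨h1, h2⟩, h3, h4⟩, h5⟩
      simp only at *
      push_cast at h5
      rcases Nat.lt_or_ge 1 s with hs | hs
      · left
        refine ⟨(s - 1, t), ?_, ?_⟩
        · rw [mem_tauSet]
          refine ⟨⟨⟨?_, ?_⟩, h3, h4⟩, ?_⟩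
          · simp only; omega
          · simp only; omega
          · simp only
            rw [Nat.cast_sub h1]
            push_cast
            linarith
        · simp only [Prod.mk.injEq, and_true]; omega
      · right
        have : s = 1 := by omega
        subst this
        refine ⟨t, ?_, rfl⟩
        rw [Finset.mem_filter, Finset.mem_Icc]
        refine ⟨⟨h3, h4⟩, ?_⟩
        push_cast at h5
        linarith
    · rintro (⟨⟨s', t'⟩, h, he⟩ | ⟨t', h, he⟩)
      · rw [mem_tauSet] at h
        obtain ⟨⟨⟨h1, h2⟩, h3, h4⟩, h5⟩ := h
        simp only [Prod.mk.injEq] at he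
        obtain ⟨rfl, rfl⟩ := he
        simp only at *
        have h3' : (1 : ℝ) ≤ t' := by exact_mod_cast h3
        have : (s' : ℝ) ≤ i := by push_cast at h5; nlinarith
        have : s' ≤ i := by exact_mod_cast this
        refine ⟨⟨⟨by omega, by omega⟩, h3, h4⟩, ?_⟩
        push_cast at *
        linarith
      · rw [Finset.mem_filter, Finset.mem_Icc] at h
        obtain ⟨⟨h3, h4⟩, h5⟩ := h
        simp only [Prod.mk.injEq] at he
        obtain ⟨rfl, rfl⟩ := he
        refine ⟨⟨⟨le_refl _, by omega⟩, h3, h4⟩, ?_⟩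
        push_cast
        linarith
  have hdisj : Disjoint (((Finset.Icc 1 m ×ˢ Finset.Icc 1 n).filter
      (fun p => (p.1 : ℝ) + (p.2 : ℝ) * ξ ≤ (i : ℝ) + ((1 : ℕ) : ℝ) * ξ)).image
        (fun p => (p.1 + 1, p.2)))
      (((Finset.Icc 1 n).filter
        (fun t : ℕ => (1 : ℝ) + (t : ℝ) * ξ ≤ (i : ℝ) + 1 + ξ)).image (fun t => (1, t))) := by
    rw [Finset.disjoint_left]
    intro q hq hq'
    rw [Finset.mem_image] at hq hq'
    obtain ⟨p, hp, rfl⟩ := hq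
    obtain ⟨t, ht, he⟩ := hq'
    rw [mem_tauSet] at hp
    simp only [Prod.mk.injEq] at he
    omega
  unfold tau
  rw [hset, Finset.card_union_of_disjoint hdisj, Finset.card_image_of_injective,
    Finset.card_image_of_injective]
  · intro x y h; simpa using h
  · rintro ⟨x, x'⟩ ⟨y, y'⟩ h; simpa using h

/-- the abstract difference equations for column `a` and row `b` -/
structure DE (m n : ℕ) (a b : ℕ → ℕ) : Prop where
  a1 : a 1 = 1
  b1 : b 1 = 1
  apos : ∀ i, 1 ≤ i → i ≤ m → 1 ≤ a i
  bpos : ∀ j, 1 ≤ j → j ≤ n → 1 ≤ b j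
  arec : ∀ i, 1 ≤ i → i + 1 ≤ m →
    a (i + 1) = a i + ((Finset.Icc 1 n).filter (fun t => b t ≤ a (i + 1))).card
  brec : ∀ j, 1 ≤ j → j + 1 ≤ n →
    b (j + 1) = b j + ((Finset.Icc 1 m).filter (fun s => a s ≤ b (j + 1))).card
  inj : ∀ i j, 1 ≤ i → i ≤ m → 1 ≤ j → j ≤ n → a i = b j → i = 1 ∧ j = 1

lemma DE.symm {m n : ℕ} {a b : ℕ → ℕ} (h : DE m n a b) : DE n m b a :=
  ⟨h.b1, h.a1, h.bpos, h.apos, h.brec, h.arec, fun i j h1 h2 h3 h4 he =>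
    (h.inj j i h3 h4 h1 h2 he.symm).symm⟩

lemma DE.b_le {m n : ℕ} {a b : ℕ → ℕ} (h : DE m n a b) {j : ℕ} (hj : 1 ≤ j) (hjn : j ≤ n) :
    b j ≤ b n := by
  induction n, hjn using Nat.le_induction with
  | base => exact le_refl _
  | succ k hk ih =>
    have hmono : ∀ d, j + d ≤ k + 1 → b j ≤ b (j + d) := by
      intro d
      induction d with
      | zero => intro _; exact le_refl _
      | succ d ihd =>
        intro hd
        have h1 := h.brec (j + d) (by omega) (by omega)
        have h2 := ihd (by omega)
        rw [← add_assoc]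
        omega
    have := hmono (k + 1 - j) (by omega)
    rwa [show j + (k + 1 - j) = k + 1 by omega] at this

def Sol (m n : ℕ) (a b : ℕ → ℕ) (ξ : ℝ) : Prop :=
  0 < ξ ∧ Irrational ξ ∧ (∀ i, 1 ≤ i → i ≤ m → a i = tau m n ξ i 1) ∧
    (∀ j, 1 ≤ j → j ≤ n → b j = tau m n ξ 1 j)

lemma Sol.symm {m n : ℕ} {a b : ℕ → ℕ} {ξ : ℝ} (h : Sol m n a b ξ) : Sol n m b a ξ⁻¹ := by
  obtain ⟨h1, h2, h3, h4⟩ := h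
  refine ⟨inv_pos.mpr h1, h2.inv, ?_, ?_⟩
  · intro i hi hi'; rw [h4 i hi hi', tau_symm m n h1]
  · intro i hi hi'; rw [h3 i hi hi', tau_symm m n h1]

lemma irr_eq {ξ : ℝ} (h : Irrational ξ) {i j k l : ℕ}
    (he : (i : ℝ) + j * ξ = k + l * ξ) : i = k ∧ j = l := by
  have hj : j = l := by
    by_contra hc
    have h0 : ((j : ℝ) - l) ≠ 0 := by
      intro h0; apply hc; have : (j : ℝ) = l := by linarith
      exact_mod_cast this
    apply h
    refine ⟨((k : ℚ) - i) / ((j : ℚ) - l), ?_⟩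
    push_cast
    rw [div_eq_iff h0]
    linarith
  subst hj
  refine ⟨?_, rfl⟩
  have : (i : ℝ) = k := by linarith
  exact_mod_cast this

lemma col_eq {m n : ℕ} {a b : ℕ → ℕ} (h : DE m n a b) (hm : 1 ≤ m) (hn : 1 ≤ n)
    {ξ : ℝ} (hξ : 0 < ξ)
    (ho : ∀ i j, 1 ≤ i → i ≤ m → 1 ≤ j → j ≤ n →
      (b j ≤ a i ↔ (1 : ℝ) + j * ξ ≤ i + ξ)) :
    ∀ i, 1 ≤ i → i ≤ m → a i = tau m n ξ i 1 := by
  intro i hi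
  induction i, hi using Nat.le_induction with
  | base => intro _; rw [h.a1, tau_one_one hm hn hξ]
  | succ i hi ih =>
    intro him
    rw [tau_succ hξ hi him, h.arec i hi him, ih (by omega)]
    congr 2
    apply Finset.filter_congr
    intro t ht
    rw [Finset.mem_Icc] at ht
    rw [ho (i + 1) t (by omega) him ht.1 ht.2]
    push_cast
    rfl

lemma sol_of_order {m n : ℕ} {a b : ℕ → ℕ} (h : DE m n a b) (hm : 1 ≤ m) (hn : 1 ≤ n)
    {ξ : ℝ} (hξ : 0 < ξ) (hirr : Irrational ξ)
    (ho : ∀ i j, 1 ≤ i → i ≤ m → 1 ≤ j → j ≤ n →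
      (a i ≤ b j ↔ (i : ℝ) + ξ ≤ 1 + j * ξ)) : Sol m n a b ξ := by
  have ho' : ∀ i j, 1 ≤ i → i ≤ m → 1 ≤ j → j ≤ n →
      (b j ≤ a i ↔ (1 : ℝ) + j * ξ ≤ i + ξ) := by
    intro i j h1 h2 h3 h4
    by_cases hij : i = 1 ∧ j = 1
    · obtain ⟨rfl, rfl⟩ := hij
      simp [h.a1, h.b1]
    · have hne : a i ≠ b j := fun he => hij (h.inj i j h1 h2 h3 h4 he)
      have hne' : (1 : ℝ) + j * ξ ≠ i + ξ := by
        intro he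
        have := irr_eq hirr (i := 1) (j := j) (k := i) (l := 1) (by push_cast; linarith)
        omega
      have := ho i j h1 h2 h3 h4
      constructor
      · intro hh
        have : ¬ (a i ≤ b j) := by omega
        rw [ho i j h1 h2 h3 h4] at this
        linarith
      · intro hh
        by_contra hc
        have : a i ≤ b j := by omega
        rw [ho i j h1 h2 h3 h4] at this
        exact hne' (by linarith)
  refine ⟨hξ, hirr, col_eq h hm hn hξ ho', ?_⟩
  intro j h1 h2
  rw [tau_symm m n hξ]
  refine col_eq h.symm hn hm (inv_pos.mpr hξ) ?_ j h1 h2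
  intro j i h3 h4 h5 h6
  rw [ho i j h5 h6 h3 h4, ← mul_le_mul_iff_left₀ (inv_pos.mpr hξ)]
  have e1 : ((i : ℝ) + ξ) * ξ⁻¹ = 1 + i * ξ⁻¹ := by field_simp; ring
  have e2 : ((1 : ℝ) + j * ξ) * ξ⁻¹ = j + ξ⁻¹ := by field_simp; ring
  rw [e1, e2]

/-- the critical slope `ξ₀ = M / (n-1)`, for which `(M+1,1)` and `(1,n)` tie -/
lemma tau_crit {M n : ℕ} (hM : 1 ≤ M) (hn : 1 ≤ n) {ξ : ℝ} (hξ : 0 < ξ)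
    (hc : (1 : ℝ) + n * ξ = M + 1 + ξ) :
    tau M n ξ 1 n + 1 = tau M n ξ M 1 + n := by
  have e1 := tau_succ (m := M + 1) (n := n) hξ hM le_rfl
  have e2 : ((Finset.Icc 1 n).filter
        (fun t : ℕ => (1 : ℝ) + (t : ℝ) * ξ ≤ (M : ℝ) + 1 + ξ)).card = n := by
    rw [Finset.filter_true_of_mem, Nat.card_Icc]
    · simp
    · intro t ht
      rw [Finset.mem_Icc] at ht
      have : (t : ℝ) ≤ n := by exact_mod_cast ht.2
      nlinarith
  rw [e2] at e1
  have e3 : tau (M + 1) n ξ (M + 1) 1 = tau (M + 1) n ξ 1 n := by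
    unfold tau
    congr 1
    apply Finset.filter_congr
    intro p _
    push_cast
    rw [hc, one_mul]
  have e4 : tau (M + 1) n ξ M 1 = tau M n ξ M 1 := by
    unfold tau
    congr 1
    ext ⟨s, t⟩
    rw [mem_tauSet, mem_tauSet]
    constructor
    · rintro ⟨⟨⟨h1, h2⟩, h3, h4⟩, h5⟩
      simp only at *
      refine ⟨⟨⟨h1, ?_⟩, h3, h4⟩, h5⟩
      have h3' : (1 : ℝ) ≤ t := by exact_mod_cast h3
      have : (s : ℝ) ≤ M := by push_cast at h5; nlinarith
      exact_mod_cast this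
    · rintro ⟨⟨⟨h1, h2⟩, h3, h4⟩, h5⟩
      exact ⟨⟨⟨h1, by omega⟩, h3, h4⟩, h5⟩
  have e5 : tau (M + 1) n ξ 1 n = tau M n ξ 1 n + 1 := by
    unfold tau
    rw [← Finset.card_insert_of_notMem (a := (M + 1, 1))]
    · congr 1
      ext ⟨s, t⟩
      rw [Finset.mem_insert, mem_tauSet, mem_tauSet]
      constructor
      · rintro ⟨⟨⟨h1, h2⟩, h3, h4⟩, h5⟩
        simp only at *
        by_cases hs : s ≤ M
        · right; exact ⟨⟨⟨h1, hs⟩, h3, h4⟩, h5⟩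
        · left
          have : s = M + 1 := by omega
          subst this
          push_cast at h5
          have : (t : ℝ) ≤ 1 := by
            by_contra hcc
            push Not at hcc
            nlinarith
          have : t ≤ 1 := by exact_mod_cast this
          ext <;> simp <;> omega
      · rintro (h | ⟨⟨⟨h1, h2⟩, h3, h4⟩, h5⟩)
        · obtain ⟨rfl, rfl⟩ := Prod.mk.inj h
          refine ⟨⟨⟨by simp, le_refl _⟩, le_refl _, hn⟩, ?_⟩
          push_cast
          linarith
        · exact ⟨⟨⟨h1, by simp only at *; omega⟩, h3, h4⟩, h5⟩
    · rw [mem_tauSet]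
      rintro ⟨⟨⟨h1, h2⟩, _⟩, _⟩
      simp only at *
      omega
  omega

/-- an irrational slightly below `ξ₀` that keeps finitely many strict inequalities -/
lemma exists_below (M n : ℕ) {ξ₀ : ℝ} (h0 : 0 < ξ₀) :
    ∃ ξ : ℝ, 0 < ξ ∧ ξ < ξ₀ ∧ Irrational ξ ∧
      ∀ i ∈ Finset.range (M + 1), ∀ j ∈ Finset.range (n + 1),
        (i : ℝ) + ξ₀ < 1 + j * ξ₀ → (i : ℝ) + ξ < 1 + j * ξ := by
  have hev : ∀ᶠ ξ in nhds ξ₀, ∀ i ∈ Finset.range (M + 1), ∀ j ∈ Finset.range (n + 1),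
        (i : ℝ) + ξ₀ < 1 + j * ξ₀ → (i : ℝ) + ξ < 1 + j * ξ := by
    rw [Filter.eventually_all_finset]
    intro i _
    rw [Filter.eventually_all_finset]
    intro j _
    by_cases hc : (i : ℝ) + ξ₀ < 1 + j * ξ₀
    · have : ∀ᶠ ξ in nhds ξ₀, (i : ℝ) + ξ < 1 + j * ξ :=
        ContinuousAt.eventually_lt (f := fun ξ : ℝ => (i : ℝ) + ξ)
          (g := fun ξ : ℝ => 1 + (j : ℝ) * ξ) (by fun_prop) (by fun_prop) hc
      filter_upwards [this] with ξ h _ using h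
    · exact Filter.Eventually.of_forall (fun ξ h => absurd h hc)
  obtain ⟨ε, hε, hball⟩ := Metric.eventually_nhds_iff.1 hev
  obtain ⟨ξ, hirr, h1, h2⟩ := exists_irrational_btwn (x := max 0 (ξ₀ - ε)) (y := ξ₀)
    (max_lt h0 (by linarith))
  rw [max_lt_iff] at h1
  refine ⟨ξ, h1.1, h2, hirr, hball ?_⟩
  rw [Real.dist_eq, abs_lt]
  constructor <;> linarith

lemma DE.shrink {M n : ℕ} {a b : ℕ → ℕ} (h : DE (M + 1) n a b)
    (hlt : b n < a (M + 1)) : DE M n a b := by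
  refine ⟨h.a1, h.b1, fun i h1 h2 => h.apos i h1 (by omega), h.bpos,
    fun i h1 h2 => h.arec i h1 (by omega), ?_, fun i j h1 h2 => h.inj i j h1 (by omega)⟩
  intro j h1 h2
  rw [h.brec j h1 h2]
  congr 2
  ext s
  rw [Finset.mem_filter, Finset.mem_filter, Finset.mem_Icc, Finset.mem_Icc,
    ← h.brec j h1 h2]
  constructor
  · rintro ⟨⟨h3, h4⟩, h5⟩
    refine ⟨⟨h3, ?_⟩, h5⟩
    by_contra hc
    have : s = M + 1 := by omega
    subst this
    have := h.b_le (j := j + 1) (by omega) h2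
    omega
  · rintro ⟨⟨h3, h4⟩, h5⟩
    exact ⟨⟨h3, by omega⟩, h5⟩

lemma extend {M n : ℕ} {a b : ℕ → ℕ} (hM : 1 ≤ M) (hn : 2 ≤ n) (h : DE (M + 1) n a b)
    (hlt : b n < a (M + 1)) {ξ : ℝ} (hs : Sol M n a b ξ) :
    ∃ ξ', Sol (M + 1) n a b ξ' := by
  obtain ⟨hξ, hirr, ha, hb⟩ := hs
  have hle : ∀ j, 1 ≤ j → j ≤ n → b j ≤ b n := fun j h1 h2 => h.b_le h1 h2
  have hlast : a (M + 1) = a M + n := by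
    rw [h.arec M hM le_rfl]
    congr 1
    rw [Finset.filter_true_of_mem, Nat.card_Icc]
    · simp
    · intro t ht
      rw [Finset.mem_Icc] at ht
      have := hle t ht.1 ht.2
      omega
  have hord : ∀ i j, 1 ≤ i → i ≤ M → 1 ≤ j → j ≤ n →
      (a i ≤ b j ↔ (i : ℝ) + ξ ≤ 1 + j * ξ) := by
    intro i j h1 h2 h3 h4
    rw [ha i h1 h2, hb j h3 h4, tau_le_iff h1 h2 le_rfl (by omega)]
    push_cast
    rw [one_mul]
  have hfin : ∀ ξ' : ℝ, 0 < ξ' → Irrational ξ' → (1 : ℝ) + n * ξ' < M + 1 + ξ' →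
      (∀ i j, 1 ≤ i → i ≤ M → 1 ≤ j → j ≤ n →
      ((i : ℝ) + ξ ≤ 1 + j * ξ ↔ (i : ℝ) + ξ' ≤ 1 + j * ξ')) → Sol (M + 1) n a b ξ' := by
    intro ξ' hp hi' hlt' heq
    refine sol_of_order h (by omega) (by omega) hp hi' ?_
    intro i j h1 h2 h3 h4
    by_cases him : i ≤ M
    · rw [hord i j h1 him h3 h4, heq i j h1 him h3 h4]
    · have : i = M + 1 := by omega
      subst this
      have h5 := hle j h3 h4
      constructor
      · intro h6; omega
      · intro h6
        exfalso
        have : (j : ℝ) ≤ n := by exact_mod_cast h4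
        push_cast at h6
        nlinarith
  have hn1 : (0 : ℝ) < (n : ℝ) - 1 := by
    have : (2 : ℝ) ≤ n := by exact_mod_cast hn
    linarith
  have hM1 : (1 : ℝ) ≤ M := by exact_mod_cast hM
  rcases lt_trichotomy ((1 : ℝ) + n * ξ) (M + 1 + ξ) with hc | hc | hc
  · exact ⟨ξ, hfin ξ hξ hirr hc (fun _ _ _ _ _ _ => Iff.rfl)⟩
  · have := irr_eq hirr (i := 1) (j := n) (k := M + 1) (l := 1) (by push_cast; linarith)
    omega
  · obtain ⟨ξ₀, hξ₀⟩ : ∃ ξ₀ : ℝ, ξ₀ = M / ((n : ℝ) - 1) := ⟨_, rfl⟩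
    have h0 : 0 < ξ₀ := by rw [hξ₀]; positivity
    have hmul : ξ₀ * ((n : ℝ) - 1) = M := by rw [hξ₀]; field_simp
    have hlt0 : ξ₀ < ξ := by
      by_contra hcc
      push Not at hcc
      nlinarith
    have hcrit := tau_crit (M := M) (n := n) hM (by omega) h0 (by linarith)
    have hrow : tau M n ξ₀ 1 n ≤ tau M n ξ 1 n := by
      unfold tau
      apply Finset.card_le_card
      intro p
      rw [mem_tauSet, mem_tauSet]
      rintro ⟨⟨h1, h3, h4⟩, h5⟩
      refine ⟨⟨h1, h3, h4⟩, ?_⟩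
      have : (p.2 : ℝ) ≤ n := by exact_mod_cast h4
      nlinarith
    have hsub : ((Finset.Icc 1 M ×ˢ Finset.Icc 1 n).filter
        (fun p => (p.1 : ℝ) + (p.2 : ℝ) * ξ ≤ (M : ℝ) + ((1 : ℕ) : ℝ) * ξ)) ⊆
        ((Finset.Icc 1 M ×ˢ Finset.Icc 1 n).filter
        (fun p => (p.1 : ℝ) + (p.2 : ℝ) * ξ₀ ≤ (M : ℝ) + ((1 : ℕ) : ℝ) * ξ₀)) := by
      intro p
      rw [mem_tauSet, mem_tauSet]
      rintro ⟨⟨h1, h3, h4⟩, h5⟩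
      refine ⟨⟨h1, h3, h4⟩, ?_⟩
      have : (1 : ℝ) ≤ p.2 := by exact_mod_cast h3
      push_cast at *
      nlinarith
    have e1 := ha M hM le_rfl
    have e2 := hb n (by omega) le_rfl
    have hcard : tau M n ξ₀ M 1 ≤ tau M n ξ M 1 := by omega
    have hseteq := Finset.eq_of_subset_of_card_le hsub hcard
    obtain ⟨ξ', hp, hl, hi', hall⟩ := exists_below M n h0
    refine ⟨ξ', hfin ξ' hp hi' (by nlinarith) ?_⟩
    intro i j h1 h2 h3 h4
    have h3' : (1 : ℝ) ≤ j := by exact_mod_cast h3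
    constructor
    · intro h5
      by_cases hj : j = 1
      · subst hj
        push_cast at *
        linarith
      · have hlt1 : (i : ℝ) + ξ₀ < 1 + j * ξ₀ := by
          by_contra hcc
          push Not at hcc
          have hmem : (M + 1 - i, j) ∈ ((Finset.Icc 1 M ×ˢ Finset.Icc 1 n).filter
              (fun p => (p.1 : ℝ) + (p.2 : ℝ) * ξ₀ ≤ (M : ℝ) + ((1 : ℕ) : ℝ) * ξ₀)) := by
            rw [mem_tauSet]
            refine ⟨⟨⟨by simp only; omega, by simp only; omega⟩, h3, h4⟩, ?_⟩
            simp only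
            rw [Nat.cast_sub (by omega)]
            push_cast
            linarith
          rw [← hseteq, mem_tauSet] at hmem
          have h6 := hmem.2
          simp only at h6
          rw [Nat.cast_sub (by omega)] at h6
          push_cast at h6
          have := irr_eq hirr (i := i) (j := 1) (k := 1) (l := j) (by push_cast; linarith)
          omega
        exact (hall i (by rw [Finset.mem_range]; omega) j
          (by rw [Finset.mem_range]; omega) hlt1).le
    · intro h5
      nlinarith

lemma exists_sol : ∀ (k m n : ℕ) (a b : ℕ → ℕ), m + n = k → 1 ≤ m → 1 ≤ n → DE m n a b →
    ∃ ξ, Sol m n a b ξ := by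
  intro k
  induction k with
  | zero => intro m n a b h h1; omega
  | succ k ih =>
    intro m n a b hk hm hn h
    have hpos2 : (0 : ℝ) < √2 := by positivity
    by_cases hm1 : m = 1
    · subst hm1
      refine ⟨√2, sol_of_order h hm hn hpos2 irrational_sqrt_two ?_⟩
      intro i j h1 h2 h3 h4
      have : i = 1 := by omega
      subst this
      have h5 := h.bpos j h3 h4
      have h3' : (1 : ℝ) ≤ j := by exact_mod_cast h3
      refine iff_of_true (by rw [h.a1]; exact h5) ?_
      push_cast
      nlinarith
    by_cases hn1 : n = 1
    · subst hn1
      refine ⟨√2, sol_of_order h hm hn hpos2 irrational_sqrt_two ?_⟩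
      intro i j h1 h2 h3 h4
      have : j = 1 := by omega
      subst this
      have h5 := h.apos i h1 h2
      constructor
      · intro h6
        have := h.inj i 1 h1 h2 h3 h4 (by rw [h.b1] at *; omega)
        rw [this.1]
        push_cast
        linarith
      · intro h6
        push_cast at h6
        have : (i : ℝ) ≤ 1 := by linarith
        have : i ≤ 1 := by exact_mod_cast this
        have : i = 1 := by omega
        rw [this, h.a1, h.b1]
    rcases lt_trichotomy (b n) (a m) with hc | hc | hc
    · obtain ⟨M, rfl⟩ : ∃ M, m = M + 1 := ⟨m - 1, by omega⟩
      obtain ⟨ξ, hs⟩ := ih M n a b (by omega) (by omega) hn (h.shrink hc)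
      exact extend (by omega) (by omega) h hc hs
    · have := h.inj m n hm le_rfl hn le_rfl hc.symm
      omega
    · obtain ⟨N, rfl⟩ : ∃ N, n = N + 1 := ⟨n - 1, by omega⟩
      obtain ⟨ξ, hs⟩ := ih N m b a (by omega) (by omega) hm (h.symm.shrink hc)
      obtain ⟨ξ', hs'⟩ := extend (by omega) (by omega) h.symm hc hs
      exact ⟨ξ'⁻¹, hs'.symm⟩

lemma mem_LShape {m n : ℕ} {p : ℕ × ℕ} : p ∈ LShape m n ↔
    ((1 ≤ p.1 ∧ p.1 ≤ m) ∧ p.2 = 1) ∨ (p.1 = 1 ∧ (1 ≤ p.2 ∧ p.2 ≤ n)) := by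
  rw [LShape, Finset.mem_union, Finset.mem_product, Finset.mem_product, Finset.mem_Icc,
    Finset.mem_Icc, Finset.mem_singleton, Finset.mem_singleton]

/-- `LY_{m,n} = E^{1,in}_{m,n}`: the injective L-shapes of difference equation
type are exactly the L-shape restrictions of (injective) Young ranking tables. -/
theorem lshapeDE_iff_young (m n : ℕ) (hm : 1 ≤ m) (hn : 1 ≤ n) (f : ℕ × ℕ → ℕ) :
    isLShapeDE m n f ↔
      ∃ ξ : ℝ, 0 < ξ ∧
        Set.InjOn (fun p : ℕ × ℕ => tau m n ξ p.1 p.2)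
          ↑(Finset.Icc 1 m ×ˢ Finset.Icc 1 n) ∧
        ∀ p ∈ LShape m n, f p = tau m n ξ p.1 p.2 := by
  have hA : ∀ i, 1 ≤ i → i ≤ m → (i, 1) ∈ LShape m n := fun i h1 h2 =>
    mem_LShape.2 (Or.inl ⟨⟨h1, h2⟩, rfl⟩)
  have hB : ∀ j, 1 ≤ j → j ≤ n → (1, j) ∈ LShape m n := fun j h1 h2 =>
    mem_LShape.2 (Or.inr ⟨rfl, ⟨h1, h2⟩⟩)
  constructor
  · rintro ⟨hinj, hrange, h11, hE1, hE2⟩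
    have hDE : DE m n (fun i => f (i, 1)) (fun j => f (1, j)) := by
      refine ⟨h11, h11, ?_, ?_, ?_, ?_, ?_⟩
      · intro i h1 h2
        exact (Finset.mem_Icc.1 (hrange _ (hA i h1 h2))).1
      · intro j h1 h2
        exact (Finset.mem_Icc.1 (hrange _ (hB j h1 h2))).1
      · intro i h1 h2
        have := hE1 i (Finset.mem_Icc.2 ⟨h1, by omega⟩)
        omega
      · intro j h1 h2
        have := hE2 j (Finset.mem_Icc.2 ⟨h1, by omega⟩)
        omega
      · intro i j h1 h2 h3 h4 he
        have := hinj (hA i h1 h2) (hB j h3 h4) he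
        obtain ⟨h5, h6⟩ := Prod.mk.inj this
        exact ⟨h5, h6.symm⟩
    obtain ⟨ξ, hξ, hirr, ha, hb⟩ := exists_sol _ m n _ _ rfl hm hn hDE
    refine ⟨ξ, hξ, ?_, ?_⟩
    · rintro ⟨i, j⟩ hp ⟨k, l⟩ hq he
      rw [Finset.mem_coe, Finset.mem_product, Finset.mem_Icc, Finset.mem_Icc] at hp hq
      simp only at hp hq he
      have l1 := (tau_le_iff hp.1.1 hp.1.2 hp.2.1 hp.2.2).1 he.le
      have l2 := (tau_le_iff hq.1.1 hq.1.2 hq.2.1 hq.2.2).1 he.ge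
      obtain ⟨rfl, rfl⟩ := irr_eq hirr (le_antisymm l1 l2)
      rfl
    · rintro ⟨i, j⟩ hp
      rcases mem_LShape.1 hp with ⟨⟨h1, h2⟩, h3⟩ | ⟨h1, h2, h3⟩
      · simp only at h1 h2 h3
        subst h3
        exact ha i h1 h2
      · simp only at h1 h2 h3
        subst h1
        exact hb j h2 h3
  · rintro ⟨ξ, hξ, hinj, hf⟩
    have hsub : ∀ p ∈ LShape m n, p ∈ Finset.Icc 1 m ×ˢ Finset.Icc 1 n := by
      intro p hp
      rw [Finset.mem_product, Finset.mem_Icc, Finset.mem_Icc]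
      rcases mem_LShape.1 hp with ⟨⟨h1, h2⟩, h3⟩ | ⟨h1, h2, h3⟩ <;> omega
    have h11 : f (1, 1) = 1 := by
      rw [hf _ (hA 1 le_rfl hm)]
      exact tau_one_one hm hn hξ
    refine ⟨?_, ?_, h11, ?_, ?_⟩
    · intro p hp q hq he
      rw [hf p hp, hf q hq] at he
      exact hinj (hsub p hp) (hsub q hq) he
    · intro p hp
      rw [hf p hp, Finset.mem_Icc]
      have hp' := hsub p hp
      rw [Finset.mem_product, Finset.mem_Icc, Finset.mem_Icc] at hp'
      constructor
      · unfold tau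
        apply Finset.card_pos.2
        exact ⟨p, mem_tauSet.2 ⟨hp', le_refl _⟩⟩
      · unfold tau
        refine (Finset.card_filter_le _ _).trans ?_
        simp
    · intro i hi
      rw [Finset.mem_Icc] at hi
      rw [hf _ (hA (i + 1) (by omega) (by omega)), hf _ (hA i (by omega) (by omega))]
      simp only
      rw [tau_succ hξ hi.1 (by omega)]
      push_cast
      rw [add_sub_cancel_left]
      congr 2
      apply Finset.filter_congr
      intro t ht
      rw [Finset.mem_Icc] at ht
      rw [hf _ (hB t ht.1 ht.2)]
      simp only
      rw [← tau_succ hξ hi.1 (by omega), tau_le_iff le_rfl hm ht.1 ht.2]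
      push_cast
      rw [one_mul]
    · intro j hj
      rw [Finset.mem_Icc] at hj
      rw [hf _ (hB (j + 1) (by omega) (by omega)), hf _ (hB j (by omega) (by omega))]
      simp only
      have hξ' := inv_pos.mpr hξ
      rw [tau_symm m n hξ 1 (j + 1), tau_symm m n hξ 1 j, tau_succ hξ' hj.1 (by omega)]
      push_cast
      rw [add_sub_cancel_left]
      congr 2
      apply Finset.filter_congr
      intro t ht
      rw [Finset.mem_Icc] at ht
      rw [hf _ (hA t ht.1 ht.2)]
      simp only
      rw [← tau_succ hξ' hj.1 (by omega), tau_symm m n hξ t 1,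
        tau_le_iff le_rfl hn ht.1 ht.2]
      push_cast
      rw [one_mul]
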